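/- There exist infinitely many natural numbers N that are a product of exactly two distinct primes and satisfy rad(φ(N)) | N − 1; in particular, there are infinitely many radimichael numbers with exactly two prime factors, none of which is a Carmichael number. -/

import Mathlib

/-- The radical of a natural number: the product of its distinct prime factors,
i.e. its largest squarefree divisor. -/
def rad (n : ℕ) : ℕ := ∏ p ∈ n.primeFactors, p

/-- A composite natural number `n` is a Carmichael number if `a ^ n ≡ a (mod n)`
for every integer `a`. -/
def IsCarmichael (n : ℕ) : Prop :=
  1 < n ∧ ¬ n.Prime ∧ ∀ a : ℤ, a ^ n ≡ a [ZMOD (n : ℤ)]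

section

open Filter Topology Asymptotics MeasureTheory

namespace DirichletCharacter

variable {q : ℕ} {χ : DirichletCharacter ℂ q}

/-- A nonprincipal character sums to zero over any complete period. -/
lemma sum_range_add_eq_zero [NeZero q] (hχ : χ ≠ 1) (m : ℕ) :
    ∑ k ∈ Finset.range q, χ ((m + k : ℕ) : ZMod q) = 0 := by
  rw [← χ.sum_eq_zero_of_ne_one hχ, ← Equiv.sum_comp (Equiv.addLeft (m : ZMod q)),
    ← Equiv.sum_comp (ZMod.finEquiv q).toEquiv, ← Fin.sum_univ_eq_sum_range
      (fun k ↦ χ ((m + k : ℕ) : ZMod q))]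
  refine Finset.sum_congr rfl fun i _ ↦ ?_
  have : ((i : ℕ) : ZMod q) = ZMod.finEquiv q i := by
    obtain _ | q := q
    · exact (NeZero.ne 0 rfl).elim
    · simp [ZMod.finEquiv]
      exact Fin.cast_val_eq_self i
  simp [this]

lemma norm_sum_range_le_natCast (m n : ℕ) :
    ‖∑ k ∈ Finset.range n, χ ((m + k : ℕ) : ZMod q)‖ ≤ n := by
  refine (norm_sum_le_of_le _ fun k _ ↦ χ.norm_le_one _).trans (by simp)

lemma norm_sum_range_le_modulus [NeZero q] (hχ : χ ≠ 1) (n m : ℕ) :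
    ‖∑ k ∈ Finset.range n, χ ((m + k : ℕ) : ZMod q)‖ ≤ q := by
  induction n using Nat.strong_induction_on generalizing m with
  | _ n ih =>
    rcases le_or_gt n q with h | h
    · exact (norm_sum_range_le_natCast m n).trans (mod_cast h)
    · obtain ⟨j, rfl⟩ := Nat.exists_eq_add_of_le h.le
      rw [Finset.sum_range_add, sum_range_add_eq_zero hχ, zero_add]
      simpa [add_assoc] using ih j (by have := NeZero.pos q; omega) (m + q)

lemma norm_sum_Icc_le_rpow [NeZero q] (hχ : χ ≠ 1) {ℓ : ℝ} (hℓ : 1 ≤ ℓ) (hq : Real.log q ≤ ℓ) (n : ℕ) :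
    ‖∑ k ∈ Finset.Icc 1 n, χ (k : ZMod q)‖ ≤ 3 * (n : ℝ) ^ (1 - 1 / ℓ) := by
  have h0 : ∑ k ∈ Finset.Icc 1 n, χ (k : ZMod q)
      = ∑ k ∈ Finset.range n, χ ((1 + k : ℕ) : ZMod q) := by
    rw [← Finset.Ico_add_one_right_eq_Icc, Finset.sum_Ico_eq_sum_range, Nat.add_sub_cancel]
  have h1 := norm_sum_range_le_natCast (χ := χ) 1 n
  have h2 := norm_sum_range_le_modulus hχ n 1
  rw [← h0] at h1 h2
  set x := ‖∑ k ∈ Finset.Icc 1 n, χ (k : ZMod q)‖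
  have hx : 0 ≤ x := norm_nonneg _
  have hl : 0 ≤ 1 / ℓ := by positivity
  have hl1 : 0 ≤ 1 - 1 / ℓ := by rw [sub_nonneg, div_le_one (by linarith)]; exact hℓ
  have hq0 : (0 : ℝ) < q := mod_cast NeZero.pos q
  have h3 : (q : ℝ) ^ (1 / ℓ) ≤ 3 := by
    rw [Real.rpow_def_of_pos hq0]
    have : Real.log q * (1 / ℓ) ≤ 1 := by
      rw [mul_one_div, div_le_one (by linarith)]; exact hq
    linarith [Real.exp_le_exp.mpr this, Real.exp_one_lt_d9]
  calc x = x ^ (1 / ℓ) * x ^ (1 - 1 / ℓ) := by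
        rw [← Real.rpow_add_of_nonneg hx hl hl1]; simp
    _ ≤ (q : ℝ) ^ (1 / ℓ) * (n : ℝ) ^ (1 - 1 / ℓ) := by gcongr
    _ ≤ _ := by gcongr

/-- The partial sums of `χ`, as a function on the reals supported on `(1, ∞)`. -/
noncomputable def partialSum (χ : DirichletCharacter ℂ q) : ℝ → ℂ :=
  (Set.Ioi 1).indicator fun t ↦ ∑ k ∈ Finset.Icc 1 ⌊t⌋₊, χ (k : ZMod q)

lemma norm_partialSum_le [NeZero q] (hχ : χ ≠ 1) {ℓ : ℝ} (hℓ : 1 ≤ ℓ) (hq : Real.log q ≤ ℓ) {t : ℝ}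
    (ht : 0 ≤ t) : ‖χ.partialSum t‖ ≤ 3 * t ^ (1 - 1 / ℓ) := by
  have hl1 : 0 ≤ 1 - 1 / ℓ := by rw [sub_nonneg, div_le_one (by linarith)]; exact hℓ
  rw [partialSum]
  by_cases h : t ∈ Set.Ioi 1
  · rw [Set.indicator_of_mem h]
    refine (norm_sum_Icc_le_rpow hχ hℓ hq _).trans ?_
    gcongr
    exact Nat.floor_le ht
  · rw [Set.indicator_of_notMem h, norm_zero]
    positivity

lemma locallyIntegrableOn_partialSum :
    LocallyIntegrableOn χ.partialSum (Set.Ioi 0) := by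
  have hmeas : Measurable χ.partialSum :=
    Measurable.indicator ((measurable_from_nat (f := fun n ↦ ∑ k ∈ Finset.Icc 1 n,
      χ (k : ZMod q))).comp Nat.measurable_floor) measurableSet_Ioi
  have hb (t : ℝ) : ‖χ.partialSum t‖ ≤ ‖|t|‖ := by
    rw [partialSum, Real.norm_eq_abs, abs_abs]
    by_cases h : t ∈ Set.Ioi 1
    · rw [Set.indicator_of_mem h]
      have : (0 : ℝ) ≤ t := by have : (1 : ℝ) < t := h; linarith
      refine (norm_sum_le_of_le _ fun k _ ↦ χ.norm_le_one _).trans ?_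
      simpa using (Nat.floor_le this).trans (le_abs_self t)
    · rw [Set.indicator_of_notMem h, norm_zero]
      positivity
  have h1 : LocallyIntegrable (fun t : ℝ ↦ |t|) := continuous_abs.locallyIntegrable
  exact (h1.mono hmeas.aestronglyMeasurable (ae_of_all _ hb)).locallyIntegrableOn _

lemma mellin_partialSum_eq (s : ℂ) : mellin χ.partialSum (-s)
    = ∫ t in Set.Ioi (1 : ℝ), (t : ℂ) ^ (-s - 1) • χ.partialSum t := by
  refine setIntegral_eq_of_subset_of_forall_sdiff_eq_zero measurableSet_Ioi
    (Set.Ioi_subset_Ioi zero_le_one) fun t ht ↦ ?_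
  rw [partialSum, Set.indicator_of_notMem ht.2, smul_zero]

lemma differentiableAt_mellin_partialSum [NeZero q] (hχ : χ ≠ 1) {ℓ : ℝ} (hℓ : 1 ≤ ℓ)
    (hq : Real.log q ≤ ℓ) {s : ℂ} (hs : 1 - 1 / ℓ < s.re) :
    DifferentiableAt ℂ (mellin χ.partialSum) (-s) := by
  refine mellin_differentiableAt_of_isBigO_rpow (a := -(1 - 1 / ℓ)) (b := -s.re - 1)
    locallyIntegrableOn_partialSum ?_ ?_ ?_ ?_
  · refine IsBigO.of_bound 3 ?_
    filter_upwards [eventually_ge_atTop 0] with t ht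
    rw [neg_neg, Real.norm_of_nonneg (Real.rpow_nonneg ht _)]
    exact norm_partialSum_le hχ hℓ hq ht
  · rw [Complex.neg_re]; linarith
  · refine IsBigO.of_bound 1 ?_
    filter_upwards [Ioo_mem_nhdsGT (zero_lt_one (α := ℝ))] with t ht
    rw [partialSum, Set.indicator_of_notMem (by simpa using ht.2.le), norm_zero]
    positivity
  · simp

lemma LFunction_eq_mul_mellin [NeZero q] (hχ : χ ≠ 1) {ℓ : ℝ} (hℓ : 1 ≤ ℓ)
    (hq : Real.log q ≤ ℓ) {s : ℂ} (hs : 1 - 1 / ℓ < s.re) :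
    LFunction χ s = s * mellin χ.partialSum (-s) := by
  have hopen : IsOpen {s : ℂ | 1 - 1 / ℓ < s.re} := isOpen_lt continuous_const Complex.continuous_re
  have h1 : AnalyticOnNhd ℂ (LFunction χ) {s : ℂ | 1 - 1 / ℓ < s.re} :=
    (differentiable_LFunction hχ).differentiableOn.analyticOnNhd hopen
  have h2 : AnalyticOnNhd ℂ (fun s ↦ s * mellin χ.partialSum (-s)) {s : ℂ | 1 - 1 / ℓ < s.re} := by
    refine DifferentiableOn.analyticOnNhd (fun s hs ↦ DifferentiableAt.differentiableWithinAt ?_)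
      hopen
    exact differentiableAt_id.mul
      ((differentiableAt_mellin_partialSum hχ hℓ hq hs).comp s differentiableAt_id.neg)
  have hl : 0 < 1 / ℓ := by positivity
  refine h1.eqOn_of_preconnected_of_eventuallyEq h2 (convex_halfSpace_re_gt _).isPreconnected
    (z₀ := 2) (by simp only [Set.mem_ofPred_eq, Complex.re_ofNat]; linarith) ?_ hs
  have : {s : ℂ | 1 < s.re} ∈ 𝓝 (2 : ℂ) :=
    (isOpen_lt continuous_const Complex.continuous_re).mem_nhds (by simp)
  filter_upwards [this] with z hz
  rw [LFunction_eq_LSeries χ hz, LSeries_eq_mul_integral' (fun n ↦ χ (n : ZMod q)) zero_le_one hz]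
  · congr 1
    rw [mellin_partialSum_eq]
    refine setIntegral_congr_fun measurableSet_Ioi fun t ht ↦ ?_
    simp only [partialSum, Set.indicator_of_mem ht, smul_eq_mul]
    rw [mul_comm, neg_add']
  · refine IsBigO.of_bound 1 (Eventually.of_forall fun n ↦ ?_)
    rw [Real.norm_of_nonneg (by positivity)]
    refine (Finset.sum_le_sum fun k _ ↦ χ.norm_le_one _).trans ?_
    simp

lemma norm_LFunction_le [NeZero q] (hχ : χ ≠ 1) {ℓ : ℝ} (hℓ : 1 ≤ ℓ) (hq : Real.log q ≤ ℓ) {s : ℂ}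
    (hs : ‖s - 1‖ ≤ 1 / (2 * ℓ)) : ‖LFunction χ s‖ ≤ 9 * ℓ := by
  have hl : 0 < 1 / ℓ := by positivity
  have hl2 : 1 / (2 * ℓ) = 1 / ℓ / 2 := by field_simp
  have hl1 : 1 / ℓ ≤ 1 := by rw [div_le_one (by linarith)]; exact hℓ
  have hre : 1 - 1 / ℓ / 2 ≤ s.re := by
    have := (abs_le.mp ((Complex.abs_re_le_norm (s - 1)).trans hs)).1
    rw [hl2] at this
    simp at this; simp; linarith
  have hsn : ‖s‖ ≤ 3 / 2 := by
    have := norm_add_le (s - 1) 1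
    simp only [sub_add_cancel, norm_one] at this
    linarith
  rw [LFunction_eq_mul_mellin hχ hℓ hq (by linarith), norm_mul]
  have hint := integrableOn_Ioi_rpow_of_lt (show -1 - 1 / ℓ / 2 < -1 by linarith)
    (zero_lt_one (α := ℝ))
  have hb : ‖mellin χ.partialSum (-s)‖ ≤ 6 * ℓ := by
    rw [mellin_partialSum_eq]
    refine (norm_integral_le_of_norm_le (hint.const_mul 3) ?_).trans ?_
    · refine (ae_restrict_iff' measurableSet_Ioi).mpr (ae_of_all _ fun t ht ↦ ?_)
      have ht1 : (1 : ℝ) < t := ht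
      have ht0 : 0 < t := by linarith
      rw [norm_smul, Complex.norm_cpow_eq_rpow_re_of_pos ht0]
      calc t ^ (-s - 1).re * ‖χ.partialSum t‖
          ≤ t ^ (-s - 1).re * (3 * t ^ (1 - 1 / ℓ)) := by
            gcongr; exact norm_partialSum_le hχ hℓ hq ht0.le
        _ = 3 * t ^ ((-s - 1).re + (1 - 1 / ℓ)) := by rw [Real.rpow_add ht0]; ring
        _ ≤ 3 * t ^ (-1 - 1 / ℓ / 2) := by
            gcongr
            · exact ht1.le
            · simp at hre ⊢; linarith
    · rw [integral_const_mul, integral_Ioi_rpow_of_lt (by linarith) zero_lt_one, Real.one_rpow]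
      apply le_of_eq
      have : -1 - 1 / ℓ / 2 + 1 ≠ 0 := by linarith
      field_simp
      ring
  calc ‖s‖ * ‖mellin χ.partialSum (-s)‖ ≤ 3 / 2 * (6 * ℓ) := by gcongr
    _ = 9 * ℓ := by ring

end DirichletCharacter

namespace DirichletCharacter

lemma exists_norm_riemannZeta_le :
    ∃ c > 0, ∀ x : ℝ, 0 < x → x ≤ c → ‖riemannZeta (1 + x)‖ ≤ 2 / x := by
  have h := (riemannZeta_residue_one.norm.eventually_lt_const
    (show ‖(1 : ℂ)‖ < 2 by simp))
  rw [eventually_nhdsWithin_iff, Metric.eventually_nhds_iff] at h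
  obtain ⟨ε, hε, h⟩ := h
  refine ⟨ε / 2, by positivity, fun x hx hxε ↦ ?_⟩
  have h1 := h (y := 1 + x) (by simp [abs_of_pos hx]; linarith) (by simp [hx.ne'])
  rw [add_sub_cancel_left, norm_mul, Complex.norm_real, Real.norm_of_nonneg hx.le] at h1
  rw [le_div_iff₀ hx]
  linarith

variable {q : ℕ} [NeZero q] {χ : DirichletCharacter ℂ q}

lemma norm_deriv_LFunction_le (hχ : χ ≠ 1) {ℓ : ℝ} (hℓ : 1 ≤ ℓ) (hq : Real.log q ≤ ℓ) {s : ℂ}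
    (hs : ‖s - 1‖ ≤ 1 / (4 * ℓ)) : ‖deriv (LFunction χ) s‖ ≤ 36 * ℓ ^ 2 := by
  have hR : 0 < 1 / (4 * ℓ) := by positivity
  refine (Complex.norm_deriv_le_of_forall_mem_sphere_norm_le (C := 9 * ℓ) hR
    (differentiable_LFunction hχ).diffContOnCl fun z hz ↦ ?_).trans_eq ?_
  · refine norm_LFunction_le hχ hℓ hq ?_
    have h1 : ‖z - s‖ = 1 / (4 * ℓ) := by simpa using hz
    calc ‖z - 1‖ = ‖(z - s) + (s - 1)‖ := by ring_nf
      _ ≤ 1 / (4 * ℓ) + 1 / (4 * ℓ) := (norm_add_le _ _).trans (add_le_add h1.le hs)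
      _ = 1 / (2 * ℓ) := by field_simp; norm_num
  · field_simp
    norm_num

lemma norm_LFunctionTrivChar_le {x : ℝ} (hx : 0 < x) :
    ‖LFunctionTrivChar q (1 + x)‖ ≤ ‖riemannZeta (1 + x)‖ := by
  rw [LFunctionTrivChar_eq_mul_riemannZeta (by simp [hx.ne']), norm_mul, norm_prod]
  refine mul_le_of_le_one_left (norm_nonneg _) (Finset.prod_le_one (fun _ _ ↦ norm_nonneg _) ?_)
  intro p hp
  have hp1 : (1 : ℝ) < p := mod_cast (Nat.prime_of_mem_primeFactors hp).one_lt
  have h1 : (p : ℂ) ^ (-(1 + x : ℂ)) = ((p : ℝ) ^ (-(1 + x)) : ℝ) := by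
    rw [Complex.ofReal_cpow (by positivity)]; push_cast; rfl
  have h2 : (p : ℝ) ^ (-(1 + x)) ≤ 1 := Real.rpow_le_one_of_one_le_of_nonpos hp1.le (by linarith)
  have h3 : 0 ≤ (p : ℝ) ^ (-(1 + x)) := by positivity
  rw [h1, ← Complex.ofReal_one, ← Complex.ofReal_sub, Complex.norm_real, Real.norm_eq_abs, abs_le]
  constructor <;> linarith

/-- A zero-free disc around `1` for the `L`-functions of complex characters, with radius a power
of the logarithm of the modulus. -/
lemma exists_disc_of_sq_ne_one :
    ∃ c > 0, ∀ (q : ℕ) [NeZero q] (χ : DirichletCharacter ℂ q), χ ^ 2 ≠ 1 →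
      ∀ ℓ : ℝ, 1 ≤ ℓ → Real.log q ≤ ℓ → ∀ s : ℂ, ‖s - 1‖ ≤ c / ℓ ^ 9 →
        LFunction χ s ≠ 0 ∧ ‖deriv (LFunction χ) s / LFunction χ s‖ ≤ ℓ ^ 9 / c := by
  obtain ⟨x₀, hx₀, hζ⟩ := exists_norm_riemannZeta_le
  refine ⟨min x₀ (1 / (72 * 144 ^ 4)), by positivity, fun q _ χ hχ ℓ hℓ hq s hs ↦ ?_⟩
  set c := min x₀ (1 / (72 * 144 ^ 4))
  have hc : 0 < c := by positivity
  have hχ1 : χ ≠ 1 := by rintro rfl; simp at hχ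
  set x := c / ℓ ^ 9 with hxdef
  have hx : 0 < x := by positivity
  have hℓ9 : 1 ≤ ℓ ^ 9 := one_le_pow₀ hℓ
  have hxc : x ≤ c := div_le_self hc.le hℓ9
  have hxℓ : x * ℓ ^ 9 ≤ 1 / (72 * 144 ^ 4) := by
    rw [hxdef, div_mul_cancel₀ _ (by positivity)]; exact min_le_right _ _
  have hxl : x ≤ 1 / (4 * ℓ) := by
    rw [le_div_iff₀ (by positivity)]
    have : x * ℓ ≤ x * ℓ ^ 9 := by
      gcongr; exact le_self_pow₀ hℓ (by norm_num)
    nlinarith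
  have hL2 : ‖LFunction (χ ^ 2) (1 + x)‖ ≤ 9 * ℓ := by
    refine norm_LFunction_le hχ hℓ hq ?_
    simp only [add_sub_cancel_left, Complex.norm_real, Real.norm_of_nonneg hx.le]
    refine hxl.trans ?_
    gcongr; norm_num
  have h341 := χ.norm_LFunction_product_ge_one hx 0
  simp only [Complex.ofReal_zero, mul_zero, add_zero, norm_mul, norm_pow] at h341
  have h0 : ‖LFunctionTrivChar q (1 + x)‖ ≤ 2 / x :=
    (norm_LFunctionTrivChar_le hx).trans (hζ x hx (hxc.trans (min_le_left _ _)))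
  set y := ‖LFunction χ (1 + x)‖ with hy
  have hlow : 144 * ℓ ^ 2 * x ≤ y := by
    by_contra! hcon
    have hy0 : 0 ≤ y := norm_nonneg _
    have h1 : (1 : ℝ) < (2 / x) ^ 3 * (144 * ℓ ^ 2 * x) ^ 4 * (9 * ℓ) :=
      h341.le.trans_lt <| by
        calc _ ≤ (2 / x) ^ 3 * y ^ 4 * (9 * ℓ) := by gcongr
          _ < _ := by gcongr
    have h2 : (2 / x) ^ 3 * (144 * ℓ ^ 2 * x) ^ 4 * (9 * ℓ) = 72 * 144 ^ 4 * (x * ℓ ^ 9) := by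
      field_simp; ring
    rw [h2] at h1
    rw [le_div_iff₀ (by norm_num)] at hxℓ
    linarith
  have hball (z : ℂ) (hz : z ∈ Metric.closedBall (1 : ℂ) x) :
      ‖deriv (LFunction χ) z‖ ≤ 36 * ℓ ^ 2 :=
    norm_deriv_LFunction_le hχ1 hℓ hq ((by simpa [dist_eq_norm] using hz : ‖z - 1‖ ≤ x).trans hxl)
  have hdiff : ‖LFunction χ (1 + x) - LFunction χ s‖ ≤ 36 * ℓ ^ 2 * ‖1 + x - s‖ :=
    (convex_closedBall (1 : ℂ) x).norm_image_sub_le_of_norm_deriv_le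
      (fun z _ ↦ differentiable_LFunction hχ1 z) hball (by simpa [dist_eq_norm] using hs)
      (by simp [abs_of_pos hx])
  have hdist : ‖1 + x - s‖ ≤ 2 * x := by
    calc ‖1 + x - s‖ = ‖(x : ℂ) - (s - 1)‖ := by ring_nf
      _ ≤ ‖(x : ℂ)‖ + ‖s - 1‖ := norm_sub_le _ _
      _ ≤ 2 * x := by rw [Complex.norm_real, Real.norm_of_nonneg hx.le]; linarith
  have hLs : 72 * ℓ ^ 2 * x ≤ ‖LFunction χ s‖ := by
    have h1 := norm_sub_norm_le (LFunction χ (1 + x)) (LFunction χ s)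
    have h2 : 36 * ℓ ^ 2 * ‖1 + x - s‖ ≤ 36 * ℓ ^ 2 * (2 * x) := by gcongr
    linarith
  have hpos : 0 < 72 * ℓ ^ 2 * x := by positivity
  refine ⟨norm_pos_iff.mp (hpos.trans_le hLs), ?_⟩
  rw [norm_div]
  calc _ ≤ 36 * ℓ ^ 2 / (72 * ℓ ^ 2 * x) := by
        gcongr
        exact hball s (by simpa [dist_eq_norm] using hs)
    _ = ℓ ^ 9 / c / 2 := by rw [hxdef]; field_simp; norm_num
    _ ≤ ℓ ^ 9 / c := by have : 0 ≤ ℓ ^ 9 / c := by positivity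
                        linarith

end DirichletCharacter

namespace DirichletCharacter

lemma eventually_logDeriv_bound {f : ℂ → ℂ} (hf : Differentiable ℂ f) (h1 : f 1 ≠ 0) :
    ∀ᶠ c : ℝ in 𝓝[>] 0, ∀ s : ℂ, ‖s - 1‖ ≤ c → f s ≠ 0 ∧ ‖deriv f s / f s‖ ≤ 1 / c := by
  have hd : ContinuousAt (fun s ↦ ‖deriv f s / f s‖) 1 :=
    ((hf.contDiff (n := 1)).continuous_deriv le_rfl).continuousAt.div hf.continuous.continuousAt h1
      |>.norm
  have hb := (hf.continuous.continuousAt.eventually_ne h1).and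
    (hd.eventually_le_const (lt_add_one _))
  obtain ⟨ε, hε, h⟩ := Metric.eventually_nhds_iff.mp hb
  set K := ‖deriv f 1 / f 1‖ + 1
  have hK : 0 < K := by positivity
  filter_upwards [Ioo_mem_nhdsGT (show 0 < min ε (1 / K) by positivity)] with c hc s hs
  obtain ⟨hc0, hc1⟩ := hc
  obtain ⟨h2, h3⟩ := h (y := s) (by
    rw [dist_eq_norm]; exact hs.trans_lt (hc1.trans_le (min_le_left _ _)))
  refine ⟨h2, h3.trans ?_⟩
  rw [le_div_iff₀ hc0, mul_comm, ← le_div_iff₀ hK]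
  exact hc1.le.trans (min_le_right _ _)

/-- A quadratic character modulo an odd number factors through the radical. -/
lemma factorsThrough_of_sq_eq_one {q r N : ℕ} [NeZero q] (hr : _root_.Odd r) (hrq : r ∣ q)
    (hqr : q ∣ r ^ N) {χ : DirichletCharacter ℂ q} (hχ : χ ^ 2 = 1) : χ.FactorsThrough r := by
  rw [factorsThrough_iff_ker_unitsMap hrq]
  intro y hy
  rw [MonoidHom.mem_ker] at hy ⊢
  have hdvd : (r : ZMod q) ∣ (y : ZMod q) - 1 := by
    have h1 : ZMod.castHom hrq (ZMod r) (y : ZMod q) = 1 := by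
      have := congrArg Units.val hy
      simpa [ZMod.unitsMap] using this
    obtain ⟨m, hm⟩ : ∃ m : ℤ, (m : ZMod q) = y := ZMod.intCast_surjective _
    rw [← hm] at h1 ⊢
    rw [map_intCast, ← sub_eq_zero, ← Int.cast_one, ← Int.cast_sub,
      ZMod.intCast_zmod_eq_zero_iff_dvd] at h1
    obtain ⟨k, hk⟩ := h1
    exact ⟨k, by rw [← Int.cast_one, ← Int.cast_sub, hk]; push_cast; rfl⟩
  have hpow : (y : ZMod q) ^ r ^ N = 1 := by
    have h1 := dvd_sub_pow_of_dvd_sub hdvd N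
    have h0 : (r : ZMod q) ^ (N + 1) = 0 := by
      rw [← Nat.cast_pow, ZMod.natCast_eq_zero_iff]
      exact hqr.trans (pow_dvd_pow _ N.le_succ)
    rw [h0, zero_dvd_iff, one_pow, sub_eq_zero] at h1
    exact h1
  obtain ⟨k, hk⟩ := hr.pow (n := N)
  have h2 : χ.toUnitHom y ^ 2 = 1 := by
    ext
    have := congrArg (fun ψ : DirichletCharacter ℂ q ↦ ψ (y : ZMod q)) hχ
    simpa [MulChar.pow_apply' _ (two_ne_zero)] using this
  have h3 : χ.toUnitHom y ^ r ^ N = 1 := by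
    rw [← map_pow, show y ^ r ^ N = 1 from Units.ext (by simpa using hpow), map_one]
  rwa [hk, pow_succ, pow_mul, h2, one_pow, one_mul] at h3

lemma LFunction_changeLevel_of_dvd_pow {q r N : ℕ} [NeZero q] [NeZero r] (hrq : r ∣ q)
    (hqr : q ∣ r ^ N) {χ : DirichletCharacter ℂ r} (hχ : χ ≠ 1) :
    LFunction (changeLevel hrq χ) = LFunction χ := by
  ext s
  rw [LFunction_changeLevel hrq χ (.inl hχ), Finset.prod_eq_one, mul_one]
  intro p hp
  have hp' := Nat.prime_of_mem_primeFactors hp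
  have hpr : p ∣ r := hp'.dvd_of_dvd_pow ((Nat.dvd_of_mem_primeFactors hp).trans hqr)
  have : χ (p : ZMod r) = 0 := by
    refine χ.map_nonunit fun h ↦ ?_
    rw [ZMod.isUnit_iff_coprime] at h
    exact hp'.one_lt.ne' (Nat.Coprime.eq_one_of_dvd h hpr)
  rw [this, zero_mul, sub_zero]

lemma LFunctionTrivChar₁_eq_of_primeFactors_eq {q r : ℕ} [NeZero q] [NeZero r]
    (h : q.primeFactors = r.primeFactors) : LFunctionTrivChar₁ q = LFunctionTrivChar₁ r := by
  ext s
  rcases eq_or_ne s 1 with rfl | hs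
  · simp [LFunctionTrivChar₁, h]
  · simp only [LFunctionTrivChar₁, Function.update_of_ne hs, LFunctionTrivChar_eq_mul_riemannZeta hs,
      h]

/-- For moduli with the same prime factors as a fixed odd number `r`, all the `L`-functions have
a common zero-free disc around `1`, with radius a power of the logarithm of the modulus. -/
lemma exists_disc_of_odd {r : ℕ} (hr : _root_.Odd r) :
    ∃ c > 0, ∀ (q : ℕ) [NeZero q], r ∣ q → (∃ N, q ∣ r ^ N) →
      ∀ ℓ : ℝ, 1 ≤ ℓ → Real.log q ≤ ℓ → ∀ s : ℂ, ‖s - 1‖ ≤ c / ℓ ^ 9 →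
        (LFunctionTrivChar₁ q s ≠ 0 ∧
          ‖deriv (LFunctionTrivChar₁ q) s / LFunctionTrivChar₁ q s‖ ≤ ℓ ^ 9 / c) ∧
        ∀ χ : DirichletCharacter ℂ q, χ ≠ 1 →
          LFunction χ s ≠ 0 ∧ ‖deriv (LFunction χ) s / LFunction χ s‖ ≤ ℓ ^ 9 / c := by
  have : NeZero r := ⟨hr.pos.ne'⟩
  obtain ⟨c₁, hc₁, h₁⟩ := exists_disc_of_sq_ne_one
  have h₂ := eventually_logDeriv_bound (differentiable_LFunctionTrivChar₁ r)
    (LFunctionTrivChar₁_apply_one_ne_zero r)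
  have h₃ : ∀ᶠ c : ℝ in 𝓝[>] 0, ∀ χ : DirichletCharacter ℂ r, χ ≠ 1 → ∀ s : ℂ, ‖s - 1‖ ≤ c →
      LFunction χ s ≠ 0 ∧ ‖deriv (LFunction χ) s / LFunction χ s‖ ≤ 1 / c := by
    rw [eventually_all]
    intro χ
    rw [eventually_imp_distrib_left]
    exact fun hχ ↦ eventually_logDeriv_bound (differentiable_LFunction hχ)
      (LFunction_apply_one_ne_zero hχ)
  obtain ⟨c, ⟨h₂, h₃⟩, hc, hcc⟩ := ((h₂.and h₃).and (Ioo_mem_nhdsGT hc₁)).exists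
  refine ⟨c, hc, fun q _ hrq hqr ℓ hℓ hq s hs ↦ ?_⟩
  obtain ⟨N, hN⟩ := hqr
  have hℓ9 : 1 ≤ ℓ ^ 9 := one_le_pow₀ hℓ
  have hs' : ‖s - 1‖ ≤ c := hs.trans (div_le_self hc.le hℓ9)
  have hcl : 1 / c ≤ ℓ ^ 9 / c := by gcongr
  refine ⟨?_, fun χ hχ ↦ ?_⟩
  · have hpf : q.primeFactors = r.primeFactors := by
      refine (Nat.primeFactors_mono hrq (NeZero.ne q)).antisymm' ?_
      intro p hp
      have hp' := Nat.prime_of_mem_primeFactors hp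
      exact Nat.mem_primeFactors.mpr ⟨hp', hp'.dvd_of_dvd_pow
        ((Nat.dvd_of_mem_primeFactors hp).trans hN), NeZero.ne r⟩
    rw [LFunctionTrivChar₁_eq_of_primeFactors_eq hpf]
    exact (h₂ s hs').imp_right hcl.trans'
  · by_cases hsq : χ ^ 2 = 1
    · obtain ⟨_, χ', hχχ⟩ := factorsThrough_of_sq_eq_one hr hrq hN hsq
      have hχ' : χ' ≠ 1 := fun h ↦ hχ (by rw [hχχ, h, map_one])
      rw [hχχ, LFunction_changeLevel_of_dvd_pow hrq hN hχ']
      exact (h₃ χ' hχ' s hs').imp_right hcl.trans'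
    · refine (h₁ q χ hsq ℓ hℓ hq s (hs.trans ?_)).imp_right fun h ↦ h.trans ?_ <;> gcongr

end DirichletCharacter

namespace ArithmeticFunction.vonMangoldt

open Complex LSeries DirichletCharacter

open scoped LSeries.notation

variable {q : ℕ}

/-- The Dirichlet series of `Λ * log ^ k` over a residue class. -/
noncomputable abbrev logPowTerm (a : ZMod q) (k : ℕ) (x : ℝ) (n : ℕ) : ℝ :=
  residueClass a n * Real.log n ^ k / (n : ℝ) ^ x

lemma iterate_logMul_residueClass (a : ZMod q) (k : ℕ) :
    logMul^[k] ↗(residueClass a) = fun n ↦ ((residueClass a n * Real.log n ^ k : ℝ) : ℂ) := by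
  induction k with
  | zero => simp
  | succ k ih =>
    rw [Function.iterate_succ_apply', ih]
    ext n
    simp only [logMul, ← natCast_log]
    push_cast; ring

lemma abscissaOfAbsConv_logPow_le_one (a : ZMod q) (k : ℕ) :
    abscissaOfAbsConv (fun n ↦ ((residueClass a n * Real.log n ^ k : ℝ) : ℂ)) ≤ 1 := by
  rw [← iterate_logMul_residueClass, absicssaOfAbsConv_logPowMul]
  exact abscissaOfAbsConv_residueClass_le_one a

lemma summable_logPowTerm (a : ZMod q) (k : ℕ) {x : ℝ} (hx : 1 < x) :
    Summable (logPowTerm a k x) :=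
  summable_real_of_abscissaOfAbsConv_lt
    ((abscissaOfAbsConv_logPow_le_one a k).trans_lt (mod_cast hx))

lemma LSeries_logPow_eq (a : ZMod q) (k : ℕ) (x : ℝ) :
    LSeries (logMul^[k] ↗(residueClass a)) x = ((∑' n, logPowTerm a k x n : ℝ) : ℂ) := by
  rw [iterate_logMul_residueClass, LSeries, ofReal_tsum]
  refine tsum_congr fun n ↦ ?_
  rcases eq_or_ne n 0 with rfl | hn
  · simp [term_zero]
  · simp only [term_of_ne_zero hn, ← ofReal_natCast n, ← ofReal_cpow n.cast_nonneg, ← ofReal_div]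

variable [NeZero q]

lemma differentiableOn_LFunctionResidueClassAux (a : ZMod q) {U : Set ℂ}
    (h₁ : ∀ s ∈ U, LFunctionTrivChar₁ q s ≠ 0)
    (h₂ : ∀ χ : DirichletCharacter ℂ q, χ ≠ 1 → ∀ s ∈ U, LFunction χ s ≠ 0) :
    DifferentiableOn ℂ (LFunctionResidueClassAux a) U := by
  have hd {f : ℂ → ℂ} (hf : Differentiable ℂ f) : Differentiable ℂ (deriv f) :=
    fun s ↦ ((hf.contDiff (n := 2)).differentiable_deriv_two) s
  unfold LFunctionResidueClassAux
  refine DifferentiableOn.const_mul (DifferentiableOn.sub ?_ (DifferentiableOn.fun_sum ?_)) _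
  · exact (hd (differentiable_LFunctionTrivChar₁ q)).neg.differentiableOn.div
      (differentiable_LFunctionTrivChar₁ q).differentiableOn h₁
  · intro χ hχ
    replace hχ : χ ≠ 1 := by simpa using hχ
    exact ((hd (differentiable_LFunction hχ)).differentiableOn.const_mul _).div
      (differentiable_LFunction hχ).differentiableOn (h₂ χ hχ)

lemma norm_LFunctionResidueClassAux_le (a : ZMod q) {s : ℂ} {K : ℝ}
    (h₁ : ‖deriv (LFunctionTrivChar₁ q) s / LFunctionTrivChar₁ q s‖ ≤ K)
    (h₂ : ∀ χ : DirichletCharacter ℂ q, χ ≠ 1 → ‖deriv (LFunction χ) s / LFunction χ s‖ ≤ K) :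
    ‖LFunctionResidueClassAux a s‖ ≤ K := by
  classical
  have hφ : (0 : ℝ) < q.totient := mod_cast Nat.totient_pos.mpr (NeZero.pos q)
  have hcard : Fintype.card (DirichletCharacter ℂ q) = q.totient := by
    rw [← Nat.card_eq_fintype_card, card_eq_totient_of_hasEnoughRootsOfUnity]
  unfold LFunctionResidueClassAux
  rw [norm_mul, norm_inv, norm_natCast, inv_mul_le_iff₀ hφ]
  calc _ ≤ ‖-deriv (LFunctionTrivChar₁ q) s / LFunctionTrivChar₁ q s‖ +
        ∑ χ ∈ ({1}ᶜ : Finset (DirichletCharacter ℂ q)),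
          ‖χ a⁻¹ * deriv (LFunction χ) s / LFunction χ s‖ :=
        (norm_sub_le _ _).trans (add_le_add le_rfl ((norm_sum_le _ _).trans_eq (by congr!)))
    _ ≤ K + ∑ χ ∈ ({1}ᶜ : Finset (DirichletCharacter ℂ q)), K := by
        refine add_le_add (by rwa [neg_div, norm_neg]) (Finset.sum_le_sum fun χ hχ ↦ ?_)
        replace hχ : χ ≠ 1 := by simpa using hχ
        rw [mul_div_assoc, norm_mul]
        exact (mul_le_of_le_one_left (norm_nonneg _) (χ.norm_le_one _)).trans (h₂ χ hχ)
    _ = q.totient * K := by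
        rw [Finset.sum_const, Finset.card_compl, Finset.card_singleton, hcard, nsmul_eq_mul,
          Nat.cast_sub (by exact_mod_cast hφ)]
        push_cast; ring

lemma abs_tsum_logPowTerm_sub_le {a : ZMod q} (ha : IsUnit a) {ρ ε : ℝ} (hε : 0 < ε)
    (hερ : ε ≤ ρ / 2) (H : ∀ s : ℂ, ‖s - 1‖ ≤ ρ →
      (LFunctionTrivChar₁ q s ≠ 0 ∧
        ‖deriv (LFunctionTrivChar₁ q) s / LFunctionTrivChar₁ q s‖ ≤ 1 / ρ) ∧
      ∀ χ : DirichletCharacter ℂ q, χ ≠ 1 →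
        LFunction χ s ≠ 0 ∧ ‖deriv (LFunction χ) s / LFunction χ s‖ ≤ 1 / ρ) (k : ℕ) :
    |∑' n, logPowTerm a k (1 + ε) n - k.factorial / (q.totient * ε ^ (k + 1))| ≤
      k.factorial * (1 / ρ) / (ρ / 2) ^ k := by
  have hρ : 0 < ρ := by linarith
  set s₀ : ℂ := ((1 + ε : ℝ) : ℂ) with hs₀
  have hs₀re : 1 < s₀.re := by rw [hs₀, ofReal_re]; linarith
  have hball {s : ℂ} (hs : ‖s - s₀‖ ≤ ρ / 2) : ‖s - 1‖ ≤ ρ := by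
    have : s - 1 = (s - s₀) + (ε : ℂ) := by rw [hs₀]; push_cast; ring
    rw [this]
    refine (norm_add_le _ _).trans ?_
    rw [norm_real, Real.norm_of_nonneg hε.le]
    linarith
  have hdiff : DifferentiableOn ℂ (LFunctionResidueClassAux a) (Metric.closedBall s₀ (ρ / 2)) := by
    refine differentiableOn_LFunctionResidueClassAux a (fun s hs ↦ (H s (hball ?_)).1.1)
      (fun χ hχ s hs ↦ ((H s (hball ?_)).2 χ hχ).1) <;> simpa [dist_eq_norm] using hs
  have hcauchy := norm_iteratedDeriv_le_of_forall_mem_sphere_norm_le k (half_pos hρ)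
    (hdiff.diffContOnCl_ball subset_rfl)
    (fun s hs ↦ norm_LFunctionResidueClassAux_le a
      (H s (hball (by simpa [dist_eq_norm] using hs.le))).1.2
      (fun χ hχ ↦ ((H s (hball (by simpa [dist_eq_norm] using hs.le))).2 χ hχ).2))
  refine le_trans (le_of_eq ?_) hcauchy
  have hev : LSeries ↗(residueClass a) =ᶠ[𝓝 s₀]
      LFunctionResidueClassAux a + fun s ↦ (q.totient : ℂ)⁻¹ * (1 * s - 1)⁻¹ := by
    filter_upwards [(isOpen_lt continuous_const continuous_re).mem_nhds hs₀re] with s hs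
    rw [Pi.add_apply, eqOn_LFunctionResidueClassAux ha hs, one_mul]
    simp [div_eq_mul_inv]
  have hε' : s₀ - 1 = (ε : ℂ) := by rw [hs₀]; push_cast; ring
  have hε0 : (ε : ℂ) ≠ 0 := by exact_mod_cast hε.ne'
  have hcd₁ : ContDiffAt ℂ k (LFunctionResidueClassAux a) s₀ :=
    ((hdiff.mono Metric.ball_subset_closedBall).contDiffOn Metric.isOpen_ball).contDiffAt
      (Metric.ball_mem_nhds _ (half_pos hρ))
  have hcd₂ : ContDiffAt ℂ k (fun s : ℂ ↦ (1 * s - 1)⁻¹) s₀ :=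
    ((contDiffAt_const.mul contDiffAt_id).sub contDiffAt_const).inv (by simp [hε', hε.ne'])
  have h1 := hev.iteratedDeriv_eq k
  rw [iteratedDeriv_add hcd₁ (contDiffAt_const.mul hcd₂), iteratedDeriv_const_mul _ hcd₂,
    LSeries_iteratedDeriv k ((abscissaOfAbsConv_residueClass_le_one a).trans_lt
      (mod_cast hs₀re)), LSeries_logPow_eq, iteratedDeriv_eq_iterate (f := fun s : ℂ ↦ (1 * s - 1)⁻¹),
    iter_deriv_inv_linear_sub] at h1
  dsimp only at h1
  rw [one_pow, mul_one, one_mul, hε', ← sub_eq_iff_eq_add] at h1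
  rw [← h1, ← Real.norm_eq_abs, ← norm_real]
  have h2 : (ε : ℂ) ^ (-1 - (k : ℤ)) = ((ε : ℂ) ^ (k + 1))⁻¹ := by
    rw [← zpow_natCast, ← zpow_neg]; congr 1; push_cast; ring
  rw [h2, show ∀ A B : ℂ, (-1) ^ k * A - (q.totient : ℂ)⁻¹ * ((-1) ^ k * k.factorial * B) =
    (-1) ^ k * (A - k.factorial * ((q.totient : ℂ)⁻¹ * B)) by intros; ring, norm_mul, norm_pow,
    norm_neg, norm_one, one_pow, one_mul]
  congr 1
  push_cast
  rw [div_eq_mul_inv _ ((q.totient : ℂ) * _), mul_inv]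

end ArithmeticFunction.vonMangoldt

section

open ArithmeticFunction ArithmeticFunction.vonMangoldt

lemma vonMangoldt_pow_div_rpow_le (p j : ℕ) :
    vonMangoldt ((p + 2) ^ (j + 2)) / (((p + 2) ^ (j + 2) : ℕ) : ℝ) ^ (3 / 4 : ℝ) ≤
      8 * ((p + 2 : ℕ) : ℝ) ^ (-(11 / 8) : ℝ) * ((2 : ℝ) ^ (-(3 / 4) : ℝ)) ^ j := by
  have hP : (2 : ℝ) ≤ ((p + 2 : ℕ) : ℝ) := by push_cast; linarith [p.cast_nonneg (α := ℝ)]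
  rw [vonMangoldt_apply_pow (by omega), Nat.cast_pow]
  have hlog : vonMangoldt (p + 2) ≤ 8 * ((p + 2 : ℕ) : ℝ) ^ (1 / 8 : ℝ) := by
    refine vonMangoldt_le_log.trans ((Real.log_le_rpow_div (Nat.cast_nonneg _) (ε := 1 / 8)
      (by norm_num)).trans_eq ?_)
    ring
  generalize ((p + 2 : ℕ) : ℝ) = P at *
  generalize vonMangoldt (p + 2) = v at *
  have hP0 : 0 < P := by linarith
  rw [div_eq_mul_inv, ← Real.rpow_natCast, ← Real.rpow_mul hP0.le, ← Real.rpow_neg hP0.le]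
  have hbP : P ^ (-(3 / 4) * j : ℝ) ≤ ((2 : ℝ) ^ (-(3 / 4) : ℝ)) ^ j := by
    rw [Real.rpow_mul hP0.le, Real.rpow_natCast]
    exact pow_le_pow_left₀ (by positivity)
      (Real.rpow_le_rpow_of_nonpos two_pos hP (by norm_num)) _
  calc _ ≤ 8 * P ^ (1 / 8 : ℝ) * P ^ (-(((j + 2 : ℕ) : ℝ) * (3 / 4))) := by gcongr
    _ = 8 * P ^ (-(11 / 8) : ℝ) * P ^ (-(3 / 4) * j : ℝ) := by
        rw [mul_assoc, mul_assoc, ← Real.rpow_add hP0, ← Real.rpow_add hP0]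
        congr 2; push_cast; ring
    _ ≤ _ := by gcongr

lemma summable_of_support_subset_pow {F : ℕ → ℝ}
    (hF : ∀ n, F n ≠ 0 → ∃ x : ℕ × ℕ, (x.1 + 2) ^ (x.2 + 2) = n)
    (hG : Summable fun x : ℕ × ℕ ↦ F ((x.1 + 2) ^ (x.2 + 2))) : Summable F := by
  have hsurj : ∀ n : Function.support F, ∃ x : ℕ × ℕ, (x.1 + 2) ^ (x.2 + 2) = (n : ℕ) :=
    fun n ↦ hF n n.2
  choose g hg using hsurj
  have hginj : Function.Injective g := fun x y h ↦ Subtype.ext (by rw [← hg x, ← hg y, h])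
  have hsub : Summable (F ∘ ((↑) : Function.support F → ℕ)) := by
    refine (hG.comp_injective hginj).congr fun n ↦ ?_
    simp only [Function.comp_apply, hg]
  have := summable_subtype_iff_indicator.mp hsub
  rwa [Set.indicator_support] at this

lemma summable_vonMangoldt_nonprime_div_rpow :
    Summable fun n : ℕ ↦ (if n.Prime then 0 else vonMangoldt n) / (n : ℝ) ^ (3 / 4 : ℝ) := by
  refine summable_of_support_subset_pow (fun n hn ↦ ?_) ?_
  · have hnp : ¬ n.Prime := fun h ↦ hn (by simp [h])
    have hΛ : vonMangoldt n ≠ 0 := fun h ↦ hn (by simp [h])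
    obtain ⟨p, k, hp, hk, rfl⟩ := (isPrimePow_nat_iff _).mp (vonMangoldt_ne_zero_iff.mp hΛ)
    have hk1 : k ≠ 1 := by rintro rfl; exact hnp (by simpa using hp)
    exact ⟨(p - 2, k - 2), by
      dsimp only; rw [Nat.sub_add_cancel hp.two_le, Nat.sub_add_cancel (by omega)]⟩
  · have h₁ : Summable fun p : ℕ ↦ 8 * ((p + 2 : ℕ) : ℝ) ^ (-(11 / 8) : ℝ) :=
      Summable.mul_left 8 ((summable_nat_add_iff (f := fun p : ℕ ↦ (p : ℝ) ^ (-(11 / 8) : ℝ)) 2).mpr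
        (Real.summable_nat_rpow.mpr (by norm_num)))
    have h₂ : Summable fun j : ℕ ↦ ((2 : ℝ) ^ (-(3 / 4) : ℝ)) ^ j :=
      summable_geometric_of_lt_one (by positivity)
        (Real.rpow_lt_one_of_one_lt_of_neg one_lt_two (by norm_num))
    refine Summable.of_nonneg_of_le (fun x ↦ ?_) (fun x ↦ ?_)
      (h₁.mul_of_nonneg h₂ (fun _ ↦ by positivity) (fun _ ↦ by positivity))
    · exact div_nonneg (by split_ifs; exacts [le_rfl, vonMangoldt_nonneg]) (by positivity)
    · have hnp : ¬ ((x.1 + 2) ^ (x.2 + 2)).Prime := Nat.Prime.not_prime_pow (by omega)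
      rw [if_neg hnp]
      exact vonMangoldt_pow_div_rpow_le x.1 x.2

lemma summable_vonMangoldt_exceptional_div_rpow (B : ℕ) :
    Summable fun n : ℕ ↦
      (if n.Prime ∧ B < n then 0 else vonMangoldt n) / (n : ℝ) ^ (3 / 4 : ℝ) := by
  refine (summable_congr_cofinite ?_).mp summable_vonMangoldt_nonprime_div_rpow
  rw [Nat.cofinite_eq_atTop]
  filter_upwards [eventually_gt_atTop B] with n hn
  simp [hn]

lemma log_pow_le_factorial_mul_rpow (k : ℕ) {x ε : ℝ} (hx : 1 ≤ x) (hε : 0 < ε) :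
    Real.log x ^ k ≤ k.factorial / ε ^ k * x ^ ε := by
  have h := Real.pow_div_factorial_le_exp (ε * Real.log x)
    (mul_nonneg hε.le (Real.log_nonneg hx)) k
  rw [mul_comm ε, ← Real.rpow_def_of_pos (by linarith), mul_pow,
    div_le_iff₀ (by positivity)] at h
  rw [div_mul_eq_mul_div, le_div_iff₀ (by positivity)]
  linarith

/-- Restricting a logarithmic Dirichlet series over a residue class to large primes costs little. -/
lemma exists_tsum_logPowTerm_le (B : ℕ) : ∃ C : ℝ, ∀ (q : ℕ) (a : ZMod q) (k : ℕ) (x : ℝ), 1 < x →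
    ∑' n, logPowTerm a k x n ≤
      ∑' n, (if n.Prime ∧ B < n then logPowTerm a k x n else 0) + k.factorial * 4 ^ k * C := by
  have hS := summable_vonMangoldt_exceptional_div_rpow B
  refine ⟨∑' n : ℕ, (if n.Prime ∧ B < n then 0 else vonMangoldt n) / (n : ℝ) ^ (3 / 4 : ℝ),
    fun q a k x hx ↦ ?_⟩
  have hsum := summable_logPowTerm a k hx
  have hsum' : Summable fun n ↦ if n.Prime ∧ B < n then logPowTerm a k x n else 0 := by
    refine (hsum.indicator {n : ℕ | n.Prime ∧ B < n}).congr fun n ↦ ?_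
    simp [Set.indicator_apply]
  rw [← tsum_mul_left, ← hsum'.tsum_add (hS.mul_left _)]
  refine hsum.tsum_le_tsum (fun n ↦ ?_) (hsum'.add (hS.mul_left _))
  split_ifs with h
  · simp
  rw [zero_add]
  rcases n.eq_zero_or_pos with rfl | hn
  · simp [logPowTerm]
  have hn1 : (1 : ℝ) ≤ n := mod_cast hn
  have hn0 : (0 : ℝ) < n := by linarith
  have hlog := log_pow_le_factorial_mul_rpow k hn1 (ε := 1 / 4) (by norm_num)
  have hx1 : (n : ℝ) ^ (1 / 4 + 3 / 4 : ℝ) ≤ (n : ℝ) ^ x :=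
    Real.rpow_le_rpow_of_exponent_le hn1 (by norm_num; exact hx.le)
  rw [Real.rpow_add hn0] at hx1
  have hΛ : 0 ≤ vonMangoldt n := vonMangoldt_nonneg
  calc logPowTerm a k x n
      ≤ vonMangoldt n * (k.factorial / (1 / 4) ^ k * (n : ℝ) ^ (1 / 4 : ℝ)) / (n : ℝ) ^ x := by
        unfold logPowTerm
        gcongr
        exact residueClass_le a n
    _ ≤ vonMangoldt n * (k.factorial / (1 / 4) ^ k * (n : ℝ) ^ (1 / 4 : ℝ)) /
        ((n : ℝ) ^ (1 / 4 : ℝ) * (n : ℝ) ^ (3 / 4 : ℝ)) := by gcongr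
    _ = _ := by
        have : ((n : ℝ) ^ (1 / 4 : ℝ)) ≠ 0 := by positivity
        rw [one_div, inv_pow, div_inv_eq_mul]
        field_simp

end

section

open ArithmeticFunction ArithmeticFunction.vonMangoldt

lemma log_pow_div_rpow_le (k : ℕ) {δ U m x : ℝ} (hδ : 0 < δ) (hU : 1 ≤ U) (hm : 1 ≤ m)
    (hx : U * m ≤ x) :
    Real.log x ^ (k + 1) / x ^ (1 + δ) ≤
      3 * (k + 1).factorial / δ ^ (k + 1) / U * (1 / m ^ (1 + δ / (k + 2))) := by
  have hUm : 1 ≤ U * m := one_le_mul_of_one_le_of_one_le hU hm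
  have hx1 : 1 ≤ x := hUm.trans hx
  have hx0 : 0 < x := by linarith
  set ε : ℝ := δ * ((k + 1) / (k + 2)) with hε
  have hε0 : 0 < ε := by positivity
  have hεδ : 1 + δ = ε + (1 + δ / (k + 2)) := by
    rw [hε]; field_simp; ring
  have hη : 0 < δ / (k + 2) := by positivity
  have h₁ := log_pow_le_factorial_mul_rpow (k + 1) hx1 hε0
  have h₂ : 1 / ε ^ (k + 1) ≤ 3 / δ ^ (k + 1) := by
    have h3 : (1 + 1 / ((k : ℝ) + 1)) ^ (k + 1) ≤ 3 := by
      have h4 : 1 + 1 / ((k : ℝ) + 1) ≤ Real.exp (1 / ((k : ℝ) + 1)) := by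
        rw [add_comm]; exact Real.add_one_le_exp _
      refine (pow_le_pow_left₀ (by positivity) h4 _).trans ?_
      rw [← Real.exp_nat_mul]
      push_cast
      rw [mul_one_div_cancel (by positivity)]
      exact (Real.exp_one_lt_d9.trans (by norm_num)).le
    have h5 : 1 / ε = (1 + 1 / ((k : ℝ) + 1)) / δ := by
      rw [hε]; field_simp; ring
    rw [← one_div_pow, h5, div_pow]
    gcongr
  have h₃ : U * m ^ (1 + δ / (k + 2)) ≤ x ^ (1 + δ / (k + 2)) := by
    refine le_trans ?_ (Real.rpow_le_rpow (by linarith) hx (by positivity))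
    rw [Real.mul_rpow (by linarith) (by linarith)]
    gcongr
    exact Real.self_le_rpow_of_one_le hU (by linarith)
  have hm0 : 0 < m := by linarith
  have hU0 : 0 < U := by linarith
  calc Real.log x ^ (k + 1) / x ^ (1 + δ)
      ≤ ((k + 1).factorial / ε ^ (k + 1) * x ^ ε) / x ^ (1 + δ) := by gcongr
    _ = (k + 1).factorial * (1 / ε ^ (k + 1)) * (1 / x ^ (1 + δ / (k + 2))) := by
        rw [hεδ, Real.rpow_add hx0]
        field_simp
    _ ≤ (k + 1).factorial * (3 / δ ^ (k + 1)) * (1 / (U * m ^ (1 + δ / (k + 2)))) := by gcongr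
    _ = _ := by field_simp

/-- If large primes `p` are determined by the prime factors of `p - 1`, then the progressions
`1 mod u`, where all `u` have the same prime factors, cannot contain many large primes. -/
lemma sum_tsum_logPowTerm_le {B U : ℕ} {R 𝒰 : Finset ℕ}
    (hB : ∀ p q : ℕ, p.Prime → q.Prime → B < p → B < q →
      (p - 1).primeFactors = (q - 1).primeFactors → p = q)
    (hR : ∀ u ∈ 𝒰, u.primeFactors = R) (hU0 : 0 < U) (hU : ∀ u ∈ 𝒰, U ≤ u) (k : ℕ) {δ : ℝ}
    (hδ : 0 < δ) :
    ∑ u ∈ 𝒰, ∑' n, (if n.Prime ∧ B < n then logPowTerm (1 : ZMod u) k (1 + δ) n else 0) ≤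
      3 * (k + 1).factorial / δ ^ (k + 1) / U *
        ∑' m : ℕ, 1 / (m : ℝ) ^ (1 + δ / (k + 2)) := by
  classical
  have hη : 0 < δ / (k + 2) := by positivity
  set M : ℝ := 3 * (k + 1).factorial / δ ^ (k + 1) / U
  have hM : 0 ≤ M := by positivity
  have hZ : Summable fun m : ℕ ↦ 1 / (m : ℝ) ^ (1 + δ / (k + 2)) :=
    Real.summable_one_div_nat_rpow.mpr (by linarith)
  have hsum (u : ℕ) : Summable fun n ↦
      if n.Prime ∧ B < n then logPowTerm (1 : ZMod u) k (1 + δ) n else 0 := by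
    refine ((summable_logPowTerm (1 : ZMod u) k (x := 1 + δ) (by linarith)).indicator
      {n : ℕ | n.Prime ∧ B < n}).congr fun n ↦ ?_
    simp [Set.indicator_apply]
  rw [← Summable.tsum_finsetSum fun u _ ↦ hsum u]
  have hnonneg (u n : ℕ) :
      0 ≤ if n.Prime ∧ B < n then logPowTerm (1 : ZMod u) k (1 + δ) n else 0 := by
    split_ifs
    · exact div_nonneg (mul_nonneg (residueClass_nonneg _ _)
        (pow_nonneg (Real.log_natCast_nonneg n) _)) (by positivity)
    · exact le_rfl
  refine Real.tsum_le_of_sum_le (fun n ↦ Finset.sum_nonneg fun u _ ↦ hnonneg u n) fun F ↦ ?_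
  rw [Finset.sum_comm, ← Finset.sum_product']
  set S : Finset (ℕ × ℕ) :=
    (𝒰 ×ˢ F).filter fun x ↦ (x.2.Prime ∧ B < x.2) ∧ x.1 ∣ x.2 - 1 with hS
  have hSm {x : ℕ × ℕ} (hx : x ∈ S) : x.1 ∈ 𝒰 ∧ x.2.Prime ∧ B < x.2 ∧ 0 < x.1 ∧
      x.2 - 1 = x.1 * ((x.2 - 1) / x.1) ∧ 0 < (x.2 - 1) / x.1 := by
    simp only [hS, Finset.mem_filter, Finset.mem_product] at hx
    obtain ⟨⟨h1, -⟩, ⟨h2, h3⟩, h4⟩ := hx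
    have hu := hU0.trans_le (hU _ h1)
    refine ⟨h1, h2, h3, hu, (Nat.mul_div_cancel' h4).symm, Nat.div_pos
      (Nat.le_of_dvd (Nat.sub_pos_of_lt h2.one_lt) h4) hu⟩
  have hinj : Set.InjOn (fun x : ℕ × ℕ ↦ (x.2 - 1) / x.1) S := by
    intro x hx y hy hxy
    obtain ⟨hx1, hx2, hx3, hx4, hx5, hx6⟩ := hSm hx
    obtain ⟨hy1, hy2, hy3, hy4, hy5, hy6⟩ := hSm hy
    dsimp only at hxy
    have h2 : x.2 = y.2 := by
      refine hB _ _ hx2 hy2 hx3 hy3 ?_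
      rw [hx5, hy5, Nat.primeFactors_mul hx4.ne' hx6.ne', Nat.primeFactors_mul hy4.ne' hy6.ne',
        hR _ hx1, hR _ hy1, hxy]
    have h1 : x.1 = y.1 := by
      rw [← hxy, ← h2] at hy5
      exact Nat.eq_of_mul_eq_mul_right hx6 (hx5.symm.trans hy5)
    exact Prod.ext h1 h2
  calc ∑ x ∈ 𝒰 ×ˢ F,
        (if x.2.Prime ∧ B < x.2 then logPowTerm (1 : ZMod x.1) k (1 + δ) x.2 else 0)
      = ∑ x ∈ S,
        (if x.2.Prime ∧ B < x.2 then logPowTerm (1 : ZMod x.1) k (1 + δ) x.2 else 0) := by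
        symm
        refine Finset.sum_subset (Finset.filter_subset _ _) fun x hx hxS ↦ ?_
        split_ifs with hp
        · have hdvd : ¬ x.1 ∣ x.2 - 1 := fun h ↦ hxS (Finset.mem_filter.mpr ⟨hx, hp, h⟩)
          have hcl : ¬ ((x.2 : ZMod x.1) = 1) := fun h ↦ hdvd <| by
            rw [← Nat.cast_one, ZMod.natCast_eq_natCast_iff, Nat.ModEq.comm] at h
            exact (Nat.modEq_iff_dvd' hp.1.one_lt.le).mp h
          simp [logPowTerm, residueClass, hcl]
        · rfl
    _ ≤ ∑ x ∈ S, M * (1 / (((x.2 - 1) / x.1 : ℕ) : ℝ) ^ (1 + δ / (k + 2))) := by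
        refine Finset.sum_le_sum fun x hx ↦ ?_
        obtain ⟨hx1, hx2, hx3, hx4, hx5, hx6⟩ := hSm hx
        rw [if_pos ⟨hx2, hx3⟩]
        refine le_trans ?_ (log_pow_div_rpow_le k hδ (x := x.2) (by exact_mod_cast hU0)
          (by exact_mod_cast hx6) ?_)
        · unfold logPowTerm
          rw [pow_succ']
          gcongr
          exact (residueClass_le _ _).trans vonMangoldt_le_log
        · norm_cast
          calc _ ≤ x.1 * ((x.2 - 1) / x.1) := Nat.mul_le_mul_right _ (hU _ hx1)
            _ ≤ x.2 := hx5 ▸ Nat.sub_le _ _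
    _ = ∑ m ∈ S.image fun x : ℕ × ℕ ↦ (x.2 - 1) / x.1, M * (1 / (m : ℝ) ^ (1 + δ / (k + 2))) :=
        (Finset.sum_image
          (f := fun m : ℕ ↦ M * (1 / (m : ℝ) ^ (1 + δ / ((k : ℝ) + 2)))) hinj).symm
    _ = M * ∑ m ∈ S.image fun x : ℕ × ℕ ↦ (x.2 - 1) / x.1, 1 / (m : ℝ) ^ (1 + δ / (k + 2)) := by
        rw [Finset.mul_sum]
    _ ≤ _ := by
        gcongr
        exact hZ.sum_le_tsum _ fun _ _ ↦ by positivity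

end

section

open ArithmeticFunction ArithmeticFunction.vonMangoldt DirichletCharacter

/-- A lower bound for the weighted number of primes congruent to `1` modulo a smooth modulus. -/
lemma le_tsum_logPowTerm_one {B q r k : ℕ} [NeZero q] {ρ δ C : ℝ} (hr : 1 ≤ r)
    (hq : q ≤ r ^ (k + 1)) (hδ : 0 < δ) (hδρ : δ = ρ / (8 * r)) (hδC : 4 * r * δ * max C 1 ≤ 1)
    (H : ∀ s : ℂ, ‖s - 1‖ ≤ ρ →
      (LFunctionTrivChar₁ q s ≠ 0 ∧
        ‖deriv (LFunctionTrivChar₁ q) s / LFunctionTrivChar₁ q s‖ ≤ 1 / ρ) ∧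
      ∀ χ : DirichletCharacter ℂ q, χ ≠ 1 →
        LFunction χ s ≠ 0 ∧ ‖deriv (LFunction χ) s / LFunction χ s‖ ≤ 1 / ρ)
    (hC : ∑' n, logPowTerm (1 : ZMod q) k (1 + δ) n ≤
      ∑' n, (if n.Prime ∧ B < n then logPowTerm (1 : ZMod q) k (1 + δ) n else 0) +
        k.factorial * 4 ^ k * C) :
    k.factorial / (2 * q * δ ^ (k + 1)) ≤
      ∑' n, (if n.Prime ∧ B < n then logPowTerm (1 : ZMod q) k (1 + δ) n else 0) := by
  have hr0 : (1 : ℝ) ≤ r := mod_cast hr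
  have hρδ : ρ = 8 * r * δ := by rw [hδρ]; field_simp
  have hδρ' : δ ≤ ρ / 2 := by rw [hρδ]; nlinarith
  have h := abs_tsum_logPowTerm_sub_le isUnit_one hδ hδρ' H k
  have h := (abs_le.mp h).1
  have hφ0 : (0 : ℝ) < q.totient := mod_cast Nat.totient_pos.mpr (NeZero.pos q)
  have hφq : (q.totient : ℝ) ≤ q := mod_cast Nat.totient_le q
  have hqr : (q : ℝ) ≤ (r : ℝ) ^ (k + 1) := mod_cast hq
  have hk : (0 : ℝ) < k.factorial := mod_cast k.factorial_pos
  set X : ℝ := k.factorial / (q.totient * δ ^ (k + 1)) with hX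
  have hXle : k.factorial / ((r : ℝ) ^ (k + 1) * δ ^ (k + 1)) ≤ X := by
    rw [hX]; gcongr; exact hφq.trans hqr
  have h₁ : k.factorial * (1 / ρ) / (ρ / 2) ^ k ≤ X / 4 := by
    have : k.factorial * (1 / ρ) / (ρ / 2) ^ k =
        (k.factorial / ((r : ℝ) ^ (k + 1) * δ ^ (k + 1))) * (1 / (2 * 4 ^ (k + 1))) := by
      rw [hρδ, show 8 * r * δ / 2 = 4 * r * δ by ring, mul_pow, mul_pow]
      field_simp
      ring
    rw [this, div_eq_mul_one_div X 4]
    have h4 : (1 : ℝ) ≤ 4 ^ k := one_le_pow₀ (by norm_num)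
    gcongr
    rw [pow_succ]; linarith
  have h₂ : k.factorial * 4 ^ k * C ≤ X / 4 := by
    have h3 : (4 * r * δ) ^ (k + 1) * C ≤ 1 := by
      have hx0 : 0 ≤ 4 * r * δ := by positivity
      have hx1 : 4 * r * δ ≤ 1 := (le_mul_of_one_le_right hx0 (le_max_right C 1)).trans hδC
      calc _ ≤ (4 * r * δ) ^ (k + 1) * max C 1 := by gcongr; exact le_max_left _ _
        _ ≤ (4 * r * δ) ^ 1 * max C 1 := by
            gcongr ?_ * _
            exact pow_le_pow_of_le_one hx0 hx1 (by omega)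
        _ ≤ 1 := by rwa [pow_one]
    have : k.factorial * 4 ^ k * C =
        (k.factorial / ((r : ℝ) ^ (k + 1) * δ ^ (k + 1))) * (1 / 4) *
          ((4 * r * δ) ^ (k + 1) * C) := by
      rw [mul_pow, mul_pow]
      field_simp
      ring
    rw [this]
    refine (mul_le_of_le_one_right (by positivity) h3).trans ?_
    linarith
  have h₃ : k.factorial / (2 * q * δ ^ (k + 1)) ≤ X / 2 := by
    rw [hX, div_div, mul_comm _ (2 : ℝ), ← mul_assoc]
    gcongr
  linarith

lemma eventually_tsum_one_div_rpow_le :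
    ∀ᶠ η : ℝ in 𝓝[>] 0, ∑' m : ℕ, 1 / (m : ℝ) ^ (1 + η) ≤ 2 / η := by
  have h := tendsto_sub_mul_tsum_nat_rpow
  have h2 : Tendsto (fun η : ℝ ↦ 1 + η) (𝓝[>] 0) (𝓝[>] 1) := by
    refine tendsto_nhdsWithin_of_tendsto_nhds_of_eventually_within _ ?_ ?_
    · exact (Continuous.tendsto' (by fun_prop) 0 1 (by simp)).mono_left nhdsWithin_le_nhds
    · filter_upwards [self_mem_nhdsWithin] with η hη
      simpa using hη
  filter_upwards [(h.comp h2).eventually_le_const one_lt_two, self_mem_nhdsWithin] with η h hη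
  rw [le_div_iff₀ hη, mul_comm]
  simpa using h

/-- If large primes `p` are determined by the prime factors of `p - 1`, then there are few numbers
between `U` and `2 * U` that divide a given power of `r`. -/
lemma exists_card_le_of_primeFactors_sub_one_injective {B r : ℕ} (hr : Odd r)
    (hB : ∀ p q : ℕ, p.Prime → q.Prime → B < p → B < q →
      (p - 1).primeFactors = (q - 1).primeFactors → p = q) :
    ∃ A : ℝ, ∀ᶠ n : ℕ in atTop, ∀ (U : ℕ) (𝒰 : Finset ℕ), 0 < U →
      (∀ u ∈ 𝒰, r ∣ u ∧ u ∣ r ^ (n + 1) ∧ U ≤ u ∧ u ≤ 2 * U) →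
        (𝒰.card : ℝ) ≤ A * ((n : ℝ) + 1) ^ 11 := by
  obtain ⟨c, hc, hdisc⟩ := exists_disc_of_odd hr
  obtain ⟨C, hC⟩ := exists_tsum_logPowTerm_le B
  have hr1 : 1 ≤ r := hr.pos
  have hr0 : (1 : ℝ) ≤ r := mod_cast hr1
  refine ⟨384 * r ^ 10 / c, ?_⟩
  set ρ : ℕ → ℝ := fun n ↦ c / (((n : ℝ) + 1) * r) ^ 9 with hρ
  set δ : ℕ → ℝ := fun n ↦ ρ n / (8 * r) with hδ
  have hρ0 (n : ℕ) : 0 < ρ n := by simp only [hρ]; positivity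
  have hδ0 (n : ℕ) : 0 < δ n := by have := hρ0 n; simp only [hδ]; positivity
  have hn1 : Tendsto (fun n : ℕ ↦ (n : ℝ) + 1) atTop atTop :=
    tendsto_atTop_add_const_right _ _ tendsto_natCast_atTop_atTop
  have hδt : Tendsto δ atTop (𝓝 0) := by
    have : Tendsto ρ atTop (𝓝 0) := tendsto_const_nhds.div_atTop
      ((tendsto_pow_atTop (by norm_num)).comp (hn1.atTop_mul_const (by linarith)))
    simpa [hδ] using this.div_const (8 * (r : ℝ))
  have hηt : Tendsto (fun n : ℕ ↦ δ n / ((n : ℝ) + 2)) atTop (𝓝[>] 0) := by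
    refine tendsto_nhdsWithin_of_tendsto_nhds_of_eventually_within _ ?_
      (.of_forall fun n ↦ div_pos (hδ0 n) (by positivity))
    exact hδt.div_atTop (tendsto_atTop_add_const_right _ _ tendsto_natCast_atTop_atTop)
  have hδC : ∀ᶠ n in atTop, 4 * r * δ n * max C 1 ≤ 1 := by
    have : Tendsto (fun n ↦ 4 * r * δ n * max C 1) atTop (𝓝 0) := by
      simpa using (hδt.const_mul (4 * (r : ℝ))).mul_const (max C 1)
    exact this.eventually_le_const one_pos
  filter_upwards [hδC, hηt.eventually eventually_tsum_one_div_rpow_le] with n hδC hη U 𝒰 hU h𝒰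
  have hupper := sum_tsum_logPowTerm_le (R := r.primeFactors) hB (𝒰 := 𝒰) (fun u hu ↦ ?_) hU
    (fun u hu ↦ (h𝒰 u hu).2.2.1) n (hδ0 n)
  swap
  · obtain ⟨h1, h2, h3, -⟩ := h𝒰 u hu
    refine (Nat.primeFactors_mono h1 (hU.trans_le h3).ne').antisymm' ?_
    rw [← Nat.primeFactors_pow r n.succ_ne_zero]
    exact Nat.primeFactors_mono h2 (pow_ne_zero _ (by omega))
  have hU1 : (0 : ℝ) < U := mod_cast hU
  have hδn := hδ0 n
  have hlower : 𝒰.card • ((n.factorial : ℝ) / (4 * U * δ n ^ (n + 1))) ≤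
      ∑ u ∈ 𝒰, ∑' m, (if m.Prime ∧ B < m then logPowTerm (1 : ZMod u) n (1 + δ n) m else 0) := by
    refine Finset.card_nsmul_le_sum _ _ _ fun u hu ↦ ?_
    obtain ⟨h1, h2, h3, h4⟩ := h𝒰 u hu
    have : NeZero u := ⟨(hU.trans_le h3).ne'⟩
    have hu0 : (0 : ℝ) < u := mod_cast NeZero.pos u
    have hur : u ≤ r ^ (n + 1) := Nat.le_of_dvd (pow_pos hr1 _) h2
    refine le_trans ?_ (le_tsum_logPowTerm_one hr1 hur (hδ0 n) rfl hδC ?_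
      (hC u 1 n (1 + δ n) (by linarith [hδ0 n])))
    · have h4' : (u : ℝ) ≤ 2 * U := mod_cast h4
      exact div_le_div_of_nonneg_left (by positivity) (by positivity)
        (mul_le_mul_of_nonneg_right (by linarith) (by positivity))
    · have := hdisc u h1 ⟨_, h2⟩ (((n : ℝ) + 1) * r)
        (one_le_mul_of_one_le_of_one_le (by linarith [n.cast_nonneg (α := ℝ)]) hr0) ?_
      · simpa only [hρ, one_div_div] using this
      · calc Real.log u ≤ Real.log ((r : ℝ) ^ (n + 1)) := by
              gcongr; exact_mod_cast hur
          _ = (n + 1) * Real.log r := by rw [Real.log_pow]; push_cast; rfl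
          _ ≤ _ := by
              gcongr
              exact Real.log_le_self (by linarith)
  have hfin := hlower.trans (hupper.trans (mul_le_mul_of_nonneg_left hη (by positivity)))
  rw [nsmul_eq_mul, Nat.factorial_succ] at hfin
  have hk : (0 : ℝ) < n.factorial := mod_cast n.factorial_pos
  have hcard : (𝒰.card : ℝ) ≤ 24 * (n + 1) * (n + 2) / δ n := by
    have hY : (0 : ℝ) < n.factorial / (4 * U * δ n ^ (n + 1)) := by positivity
    refine le_of_mul_le_mul_right (hfin.trans_eq ?_) hY
    push_cast
    field_simp
    ring
  refine hcard.trans ?_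
  have hδe : δ n = c / (8 * r ^ 10 * ((n : ℝ) + 1) ^ 9) := by
    simp only [hδ, hρ]
    rw [mul_pow]; field_simp
  rw [hδe]
  have : (n : ℝ) + 2 ≤ 2 * (n + 1) := by linarith [n.cast_nonneg (α := ℝ)]
  calc 24 * ((n : ℝ) + 1) * (n + 2) / (c / (8 * r ^ 10 * ((n : ℝ) + 1) ^ 9))
      ≤ 24 * ((n : ℝ) + 1) * (2 * (n + 1)) / (c / (8 * r ^ 10 * ((n : ℝ) + 1) ^ 9)) := by gcongr
    _ = _ := by field_simp; ring

end

lemma card_divisors_pow_ge (r n : ℕ) (hr : r ≠ 0) :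
    (n + 1) ^ r.primeFactors.card ≤ (r ^ n).divisors.card := by
  rcases n.eq_zero_or_pos with rfl | hn
  · simp
  rw [Nat.card_divisors (pow_ne_zero _ hr), Nat.primeFactors_pow _ hn.ne']
  refine Finset.pow_card_le_prod _ _ _ fun p hp ↦ ?_
  rw [Nat.factorization_pow]
  have : 0 < r.factorization p := (Nat.prime_of_mem_primeFactors hp).factorization_pos_of_dvd hr
    (Nat.dvd_of_mem_primeFactors hp)
  simpa using Nat.le_mul_of_pos_right n this

/-- Some dyadic interval contains many multiples of `r` dividing a power of `r`. -/
lemma exists_dyadic_divisors {r n M : ℕ} (hr : r ≠ 0)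
    (hM : (r * (n + 1)) * M < (n + 1) ^ r.primeFactors.card) :
    ∃ (U : ℕ) (𝒰 : Finset ℕ), 0 < U ∧
      (∀ u ∈ 𝒰, r ∣ u ∧ u ∣ r ^ (n + 1) ∧ U ≤ u ∧ u ≤ 2 * U) ∧ M < 𝒰.card := by
  have hr0 : 0 < r := Nat.pos_of_ne_zero hr
  have hmaps : ∀ d ∈ (r ^ n).divisors, Nat.log 2 d ∈ Finset.range (r * (n + 1)) := by
    intro d hd
    rw [Finset.mem_range]
    refine Nat.log_lt_of_lt_pow (Nat.pos_of_mem_divisors hd).ne' ?_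
    calc d ≤ r ^ n := Nat.divisor_le hd
      _ ≤ (2 ^ r) ^ n := Nat.pow_le_pow_left Nat.lt_two_pow_self.le n
      _ = 2 ^ (r * n) := (pow_mul _ _ _).symm
      _ < 2 ^ (r * (n + 1)) := Nat.pow_lt_pow_right one_lt_two (by nlinarith)
  obtain ⟨j, -, hj⟩ := Finset.exists_lt_card_fiber_of_mul_lt_card_of_maps_to hmaps (n := M)
    (by rw [Finset.card_range]; exact hM.trans_le (card_divisors_pow_ge r n hr))
  refine ⟨r * 2 ^ j, ((r ^ n).divisors.filter fun d ↦ Nat.log 2 d = j).image (r * ·),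
    by positivity, fun u hu ↦ ?_, ?_⟩
  · obtain ⟨d, hd, rfl⟩ := Finset.mem_image.mp hu
    obtain ⟨hd, hdj⟩ := Finset.mem_filter.mp hd
    have hd0 := (Nat.pos_of_mem_divisors hd).ne'
    refine ⟨dvd_mul_right _ _, ?_, ?_, ?_⟩
    · rw [pow_succ']
      exact mul_dvd_mul_left _ (Nat.dvd_of_mem_divisors hd)
    · exact Nat.mul_le_mul_left _ (hdj ▸ Nat.pow_log_le_self 2 hd0)
    · have := (Nat.lt_pow_succ_log_self one_lt_two d).le
      rw [hdj, pow_succ] at this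
      nlinarith
  · rwa [Finset.card_image_of_injective _ (fun _ _ h ↦ Nat.eq_of_mul_eq_mul_left hr0 h)]

/-- There are arbitrarily large pairs of distinct primes `p`, `q` such that `p - 1` and `q - 1` have
the same prime factors. -/
lemma exists_primes_primeFactors_sub_one_eq (B : ℕ) :
    ∃ p q : ℕ, p.Prime ∧ q.Prime ∧ B < p ∧ B < q ∧
      (p - 1).primeFactors = (q - 1).primeFactors ∧ p ≠ q := by
  by_contra! hcon
  set S : Finset ℕ := {3, 5, 7, 11, 13, 17, 19, 23, 29, 31, 37, 41, 43} with hS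
  have hSp : ∀ p ∈ S, p.Prime := by
    intro p hp
    simp only [hS, Finset.mem_insert, Finset.mem_singleton] at hp
    rcases hp with rfl | rfl | rfl | rfl | rfl | rfl | rfl | rfl | rfl | rfl | rfl | rfl | rfl <;>
      norm_num
  have hScard : S.card = 13 := rfl
  set r : ℕ := ∏ p ∈ S, p with hr
  have hpf : r.primeFactors = S := Nat.primeFactors_prod hSp
  have hr0 : r ≠ 0 := Finset.prod_ne_zero_iff.mpr fun p hp ↦ (hSp p hp).ne_zero
  have hodd : Odd r := by
    rw [← Nat.not_even_iff_odd, even_iff_two_dvd]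
    intro h
    have : 2 ∈ r.primeFactors := Nat.mem_primeFactors.mpr ⟨Nat.prime_two, h, hr0⟩
    rw [hpf] at this
    simp [hS] at this
  clear_value r
  obtain ⟨A, hA⟩ := exists_card_le_of_primeFactors_sub_one_injective (B := B) hodd hcon
  obtain ⟨D, hD⟩ := exists_nat_gt A
  obtain ⟨n, hn, hnD⟩ := (hA.and (eventually_gt_atTop (r * D))).exists
  obtain ⟨U, 𝒰, hU, h𝒰, hcard⟩ := exists_dyadic_divisors (r := r) (n := n)
    (M := D * (n + 1) ^ 11) hr0 (by
      rw [hpf, hScard]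
      calc r * (n + 1) * (D * (n + 1) ^ 11) = r * D * (n + 1) ^ 12 := by ring
        _ < (n + 1) * (n + 1) ^ 12 := by gcongr; omega
        _ = _ := by ring)
  have h₁ := hn U 𝒰 hU h𝒰
  have h₂ : (D : ℝ) * ((n : ℝ) + 1) ^ 11 < 𝒰.card := mod_cast hcard
  have h₃ : A * ((n : ℝ) + 1) ^ 11 ≤ D * ((n : ℝ) + 1) ^ 11 := by gcongr
  linarith

lemma primeFactors_totient_mul_of_primeFactors_sub_one_eq {p q : ℕ} (hp : p.Prime) (hq : q.Prime)
    (hpq : p ≠ q) (h : (p - 1).primeFactors = (q - 1).primeFactors) :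
    (Nat.totient (p * q)).primeFactors = (p - 1).primeFactors := by
  rw [Nat.totient_mul ((Nat.coprime_primes hp hq).mpr hpq), Nat.totient_prime hp,
    Nat.totient_prime hq, Nat.primeFactors_mul (Nat.sub_ne_zero_of_lt hp.one_lt)
      (Nat.sub_ne_zero_of_lt hq.one_lt), h, Finset.union_self]

lemma rad_totient_mul_dvd {p q : ℕ} (hp : p.Prime) (hq : q.Prime)
    (hpq : p ≠ q) (h : (p - 1).primeFactors = (q - 1).primeFactors) :
    rad (Nat.totient (p * q)) ∣ p * q - 1 := by
  unfold rad
  rw [primeFactors_totient_mul_of_primeFactors_sub_one_eq hp hq hpq h]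
  have h₁ : ∏ ℓ ∈ (p - 1).primeFactors, ℓ ∣ p - 1 := Nat.prod_primeFactors_dvd _
  have h₂ : ∏ ℓ ∈ (p - 1).primeFactors, ℓ ∣ q - 1 := h ▸ Nat.prod_primeFactors_dvd _
  have : p * q - 1 = (p - 1) * q + (q - 1) := by
    obtain ⟨a, rfl⟩ := Nat.exists_eq_add_of_le' hp.one_lt.le
    obtain ⟨b, rfl⟩ := Nat.exists_eq_add_of_le' hq.one_lt.le
    simp only [Nat.add_sub_cancel]
    rw [Nat.sub_eq_iff_eq_add (by nlinarith)]
    ring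
  rw [this]
  exact dvd_add (h₁.mul_right _) h₂

lemma not_isCarmichael_mul_of_lt {p q : ℕ} (hp : p.Prime) (hq : q.Prime) (hpq : p < q) :
    ¬ IsCarmichael (p * q) := by
  rintro ⟨-, -, h⟩
  have : Fact q.Prime := ⟨hq⟩
  obtain ⟨g, hg⟩ := IsCyclic.exists_ofOrder_eq_natCard (α := (ZMod q)ˣ)
  rw [Nat.card_eq_fintype_card, ZMod.card_units] at hg
  obtain ⟨a, ha⟩ := ZMod.intCast_surjective (g : ZMod q)
  have h1 : ((a ^ (p * q) : ℤ) : ZMod q) = (a : ℤ) := by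
    rw [ZMod.intCast_eq_intCast_iff]
    exact (h a).of_mul_left p |>.trans rfl
  rw [Int.cast_pow, ha, pow_mul, ZMod.pow_card] at h1
  have h2 : g ^ p = g := Units.ext (by simpa using h1)
  have h3 : g ^ (p - 1) = 1 := by
    have h4 : g ^ (p - 1) * g = 1 * g := by
      rw [← pow_succ, Nat.sub_add_cancel hp.one_lt.le, h2, one_mul]
    exact mul_right_cancel h4
  have h5 := Nat.le_of_dvd (Nat.sub_pos_of_lt hp.one_lt) (hg ▸ orderOf_dvd_of_pow_eq_one h3)
  have := hp.one_lt
  omega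

lemma not_isCarmichael_mul {p q : ℕ} (hp : p.Prime) (hq : q.Prime) (hpq : p ≠ q) :
    ¬ IsCarmichael (p * q) := by
  rcases hpq.lt_or_gt with h | h
  · exact not_isCarmichael_mul_of_lt hp hq h
  · rw [mul_comm]
    exact not_isCarmichael_mul_of_lt hq hp h

end

/-- There are infinitely many `N` that are products of exactly two distinct primes
with `rad (φ N) ∣ N - 1`; none of these is a Carmichael number. -/
theorem infinitely_many_radimichael_two_factors :
    {N : ℕ | (∃ p q : ℕ, p.Prime ∧ q.Prime ∧ p ≠ q ∧ N = p * q) ∧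
      rad (Nat.totient N) ∣ N - 1 ∧ ¬ IsCarmichael N}.Infinite := by
  refine Set.infinite_of_forall_exists_gt fun B ↦ ?_
  obtain ⟨p, q, hp, hq, hBp, -, h, hpq⟩ := exists_primes_primeFactors_sub_one_eq B
  exact ⟨p * q, ⟨⟨p, q, hp, hq, hpq, rfl⟩, rad_totient_mul_dvd hp hq hpq h,
    not_isCarmichael_mul hp hq hpq⟩, hBp.trans_le (Nat.le_mul_of_pos_right p hq.pos)⟩
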